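/- Assume that R_n / p_{2n} → 1 as n → ∞ (Sondow's asymptotic for Ramanujan primes). Let π_R(x) denote the number of Ramanujan primes not exceeding x. Then π_R(x) ~ x/(2 ln x) as x → ∞, i.e., the limit of π_R(x)·(2 ln x)/x is 1. -/

import Mathlib

/-- `nthPrime n` is the n-th prime with 1-based indexing: p_1 = 2, p_2 = 3, ... -/
noncomputable def nthPrime (n : ℕ) : ℕ := Nat.nth Nat.Prime (n - 1)

/-- The n-th Ramanujan prime: the smallest positive integer R such that for all
integers x ≥ R one has π(x) − π(⌊x/2⌋) ≥ n. -/
noncomputable def ramanujan (n : ℕ) : ℕ :=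
  sInf {R : ℕ | 0 < R ∧ ∀ x : ℕ, R ≤ x →
    n ≤ Nat.primeCounting x - Nat.primeCounting (x / 2)}

/-- A Ramanujan prime is a number of the form R_n for some n ≥ 1. -/
def IsRamanujanPrime (p : ℕ) : Prop := ∃ n : ℕ, 1 ≤ n ∧ p = ramanujan n

/-- π_R(x): the number of Ramanujan primes not exceeding x. -/
noncomputable def countRam (x : ℕ) : ℕ :=
  letI := Classical.decPred IsRamanujanPrime
  ((Finset.range (x + 1)).filter IsRamanujanPrime).card

open MeasureTheory Filter Topology FourierTransform

/-- A Fejér kernel: a nonnegative integrable function of integral `1` which is almost everywhere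
the Fourier transform of a continuous compactly supported function. -/
theorem exists_fejer_kernel : ∃ (φ : ℝ → ℂ) (K : ℝ → ℝ), Continuous φ ∧ HasCompactSupport φ ∧
    Integrable K ∧ (∀ x, 0 ≤ K x) ∧ ∫ x, K x = 1 ∧ 𝓕 φ =ᵐ[volume] fun x ↦ (K x : ℂ) := by
  let f : ℝ → ℝ := fun t ↦ max 0 (1 - |t|)
  let φ : ℝ → ℂ := fun t ↦ (f t : ℂ)
  let K : ℝ → ℝ := fun x ↦ (1 - Real.cos (2 * Real.pi * x)) / (2 * Real.pi ^ 2 * x ^ 2)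
  have hf : Continuous f := by fun_prop
  have hφ : Continuous φ := by fun_prop
  have hf0 : ∀ t, t ∉ Set.Icc (-1 : ℝ) 1 → φ t = 0 := by
    intro t ht
    have : 1 ≤ |t| := by
      by_contra! h
      exact ht ⟨(abs_lt.1 h).1.le, (abs_lt.1 h).2.le⟩
    simp [φ, f, this]
  have hsupp : HasCompactSupport φ := HasCompactSupport.intro isCompact_Icc hf0
  have hK0 : ∀ x, 0 ≤ K x := fun x ↦
    div_nonneg (sub_nonneg.2 (Real.cos_le_one _)) (by positivity)
  have hKle : ∀ x, K x ≤ 2 * (1 + x ^ 2)⁻¹ := by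
    intro x
    rcases eq_or_ne x 0 with rfl | hx
    · simp [K]
    have hx2 : 0 < x ^ 2 := by positivity
    have h1 := Real.one_sub_sq_div_two_le_cos (x := 2 * Real.pi * x)
    have h2 := Real.neg_one_le_cos (2 * Real.pi * x)
    have h3 := Real.pi_gt_three
    rw [← div_eq_mul_inv, div_le_div_iff₀ (by positivity) (by positivity)]
    have h4 : (9 : ℝ) ≤ Real.pi ^ 2 := by nlinarith
    nlinarith [mul_le_mul_of_nonneg_right h4 hx2.le]
  have hKm : Measurable K := by fun_prop
  have hKi : Integrable K := by
    refine (integrable_inv_one_add_sq.const_mul 2).mono' hKm.aestronglyMeasurable ?_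
    refine .of_forall fun x ↦ ?_
    rw [Real.norm_of_nonneg (hK0 x)]
    exact hKle x
  have hFK : ∀ x, x ≠ 0 → 𝓕 φ x = (K x : ℂ) := by
    intro x hx
    set w : ℂ := -(2 * Real.pi * x) * Complex.I with hw
    have hw0 : w ≠ 0 := by simp [hw, hx, Real.pi_ne_zero]
    rw [Real.fourier_real_eq_integral_exp_smul]
    have hcont : Continuous fun t : ℝ ↦ Complex.exp (w * t) * φ t := by fun_prop
    have e1 : (∫ v : ℝ, Complex.exp (↑(-2 * Real.pi * v * x) * Complex.I) • φ v) =
        ∫ t in (-1 : ℝ)..1, Complex.exp (w * t) * φ t := by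
      rw [intervalIntegral.integral_of_le (by norm_num), ← integral_Icc_eq_integral_Ioc,
        setIntegral_eq_integral_of_forall_compl_eq_zero]
      · refine integral_congr_ae (.of_forall fun t ↦ ?_)
        simp only [smul_eq_mul, hw]
        congr 2
        push_cast; ring
      · intro t ht
        rw [hf0 t ht, mul_zero]
    have e2 : (∫ t in (0 : ℝ)..1, Complex.exp (w * t) * φ t) =
        Complex.exp w / w ^ 2 - (1 / w + 1 / w ^ 2) := by
      have hd : ∀ t : ℝ, HasDerivAt (fun t : ℝ ↦ (1 - (t : ℂ)) * Complex.exp (w * t) / w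
          + Complex.exp (w * t) / w ^ 2) (Complex.exp (w * t) * (1 - t)) t := by
        intro t
        have h1 : HasDerivAt (fun t : ℝ ↦ (t : ℂ)) 1 t := Complex.ofRealCLM.hasDerivAt
        have h2 := (h1.const_mul w).cexp
        have := (((h1.const_sub 1).mul h2).div_const w).add (h2.div_const (w ^ 2))
        refine this.congr_deriv ?_
        field_simp
        ring
      have := intervalIntegral.integral_eq_sub_of_hasDerivAt (a := 0) (b := 1)
        (fun t _ ↦ hd t) ((by fun_prop : Continuous _).intervalIntegrable _ _)
      rw [intervalIntegral.integral_congr (g := fun t : ℝ ↦ Complex.exp (w * t) * (1 - t)), this]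
      · simp
      · intro t ht
        rw [Set.uIcc_of_le (by norm_num)] at ht
        simp only [φ, f, abs_of_nonneg ht.1]
        rw [max_eq_right (by linarith [ht.2])]
        push_cast; ring
    have e3 : (∫ t in (-1 : ℝ)..0, Complex.exp (w * t) * φ t) =
        (1 / w - 1 / w ^ 2) + Complex.exp (-w) / w ^ 2 := by
      have hd : ∀ t : ℝ, HasDerivAt (fun t : ℝ ↦ (1 + (t : ℂ)) * Complex.exp (w * t) / w
          - Complex.exp (w * t) / w ^ 2) (Complex.exp (w * t) * (1 + t)) t := by
        intro t
        have h1 : HasDerivAt (fun t : ℝ ↦ (t : ℂ)) 1 t := Complex.ofRealCLM.hasDerivAt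
        have h2 := (h1.const_mul w).cexp
        have := (((h1.const_add 1).mul h2).div_const w).sub (h2.div_const (w ^ 2))
        refine this.congr_deriv ?_
        field_simp
        ring
      have := intervalIntegral.integral_eq_sub_of_hasDerivAt (a := -1) (b := 0)
        (fun t _ ↦ hd t) ((by fun_prop : Continuous _).intervalIntegrable _ _)
      rw [intervalIntegral.integral_congr (g := fun t : ℝ ↦ Complex.exp (w * t) * (1 + t)), this]
      · simp
      · intro t ht
        rw [Set.uIcc_of_le (by norm_num)] at ht
        simp only [φ, f, abs_of_nonpos ht.2]
        rw [max_eq_right (by linarith [ht.1])]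
        push_cast; ring
    rw [e1, ← intervalIntegral.integral_add_adjacent_intervals (b := 0)
      (hcont.intervalIntegrable _ _) (hcont.intervalIntegrable _ _), e2, e3]
    have hcos : Complex.exp w + Complex.exp (-w) = 2 * Complex.cos (2 * Real.pi * x) := by
      rw [Complex.two_cos, hw, add_comm]
      congr 2
      ring
    have hw2 : w ^ 2 = -(4 * Real.pi ^ 2 * x ^ 2) := by
      rw [hw, mul_pow, Complex.I_sq]; ring
    have hx' : (x : ℂ) ≠ 0 := by exact_mod_cast hx
    have hpi : (Real.pi : ℂ) ≠ 0 := by exact_mod_cast Real.pi_ne_zero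
    calc _ = (Complex.exp w + Complex.exp (-w) - 2) / w ^ 2 := by ring
      _ = _ := by
        rw [hcos, hw2]
        simp only [K]
        push_cast
        field_simp
        ring
  have hae : 𝓕 φ =ᵐ[volume] fun x ↦ (K x : ℂ) := by
    filter_upwards [compl_mem_ae_iff.2 (measure_singleton (0 : ℝ))] with x hx
    exact hFK x hx
  refine ⟨φ, K, hφ, hsupp, hKi, hK0, ?_, hae⟩
  have hinv := hφ.fourierInv_fourier_eq (hφ.integrable_of_hasCompactSupport hsupp)
    (hKi.ofReal.congr hae.symm)
  have h0 := congrFun hinv 0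
  rw [Real.fourierInv_eq' ] at h0
  simp only [inner_zero_right, mul_zero, Complex.ofReal_zero, zero_mul, Complex.exp_zero,
    one_smul] at h0
  rw [integral_congr_ae hae, integral_complex_ofReal] at h0
  have : φ 0 = ((1 : ℝ) : ℂ) := by simp [φ, f]
  rw [this] at h0
  exact_mod_cast h0

/-- If the Laplace transform of a bounded function `h` extends continuously to the closed right
half-plane, then averages of `h` against Fourier transforms of compactly supported functions tend
to zero. -/
theorem tendsto_integral_fourier_mul_comp_zero {h : ℝ → ℂ} {C : ℝ} (hm : Measurable h)
    (hC : ∀ u, ‖h u‖ ≤ C) (h0 : ∀ u ≤ 0, h u = 0) {G : ℂ → ℂ}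
    (hG : ContinuousOn G {s | 0 ≤ s.re})
    (hL : ∀ s : ℂ, 0 < s.re → ∫ u : ℝ, h u * Complex.exp (-s * u) = G s)
    {φ : ℝ → ℂ} (hφ : Continuous φ) (hsupp : HasCompactSupport φ) (hF : Integrable (𝓕 φ))
    {l : ℝ} (hl : 0 < l) :
    Tendsto (fun v : ℝ ↦ ∫ y : ℝ, 𝓕 φ y * h (v + y / l)) atTop (𝓝 0) := by
  have hφi : Integrable φ := hφ.integrable_of_hasCompactSupport hsupp
  have hC0 : 0 ≤ C := (norm_nonneg _).trans (hC 0)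
  let g : ℝ → ℝ → ℝ → ℂ := fun σ v y ↦ h (v + y / l) * Complex.exp (-σ * (v + y / l : ℝ))
  let Γ : ℝ → ℝ → ℂ := fun σ t ↦ G ((max σ 0 : ℝ) + 2 * Real.pi * l * t * Complex.I)
  have hΓ : Continuous (Function.uncurry Γ) := by
    refine hG.comp_continuous (f := fun p : ℝ × ℝ ↦
      ((max p.1 0 : ℝ) : ℂ) + 2 * Real.pi * l * p.2 * Complex.I) (by fun_prop) fun p ↦ ?_
    simp
  have hint : ∀ σ : ℝ, 0 < σ → Integrable fun u : ℝ ↦ h u * Complex.exp (-(σ : ℂ) * u) := by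
    intro σ hσ
    have h1 : IntegrableOn (fun u : ℝ ↦ C * Real.exp (-σ * u)) (Set.Ioi 0) :=
      (integrableOn_exp_mul_Ioi (neg_lt_zero.2 hσ) 0).const_mul C
    refine ((integrable_indicator_iff measurableSet_Ioi).2 h1).mono'
      (by fun_prop : Measurable _).aestronglyMeasurable (.of_forall fun u ↦ ?_)
    rcases le_or_gt u 0 with hu | hu
    · rw [h0 u hu, zero_mul, norm_zero]
      exact Set.indicator_nonneg (fun _ _ ↦ by positivity) u
    · rw [Set.indicator_of_mem (Set.mem_Ioi.2 hu), norm_mul, Complex.norm_exp]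
      have : (-(σ : ℂ) * u).re = -σ * u := by simp
      rw [this]
      gcongr
      exact hC u
  have hswap : ∀ σ : ℝ, 0 < σ → ∀ v : ℝ, ∫ y : ℝ, 𝓕 φ y * g σ v y =
      ∫ t, φ t * (l * Complex.exp (2 * Real.pi * l * v * t * Complex.I) * Γ σ t) := by
    intro σ hσ v
    have hgi : Integrable (g σ v) :=
      ((hint σ hσ).comp_add_left v).comp_div hl.ne'
    have hflip := VectorFourier.integral_fourierIntegral_smul_eq_flip (μ := volume) (ν := volume)
      (L := innerₗ ℝ) Real.continuous_fourierChar (by exact continuous_inner) hφi hgi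
    have hflip' : ∫ y, 𝓕 φ y * g σ v y = ∫ t, φ t * 𝓕 (g σ v) t := by
      simpa [flip_innerₗ] using! hflip
    rw [hflip']
    congr 1 with t
    congr 1
    rw [Real.fourier_real_eq_integral_exp_smul]
    let Φ : ℝ → ℂ := fun u ↦ Complex.exp (2 * Real.pi * l * v * t * Complex.I) *
      (h u * Complex.exp (-(σ + 2 * Real.pi * l * t * Complex.I) * u))
    have e1 : (∫ y : ℝ, Complex.exp (↑(-2 * Real.pi * y * t) * Complex.I) • g σ v y) =
        ∫ y : ℝ, Φ (v + y / l) := by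
      congr 1 with y
      simp only [g, Φ, smul_eq_mul]
      rw [mul_left_comm, mul_left_comm (Complex.exp _), ← Complex.exp_add, ← Complex.exp_add]
      congr 2
      have : (l : ℂ) ≠ 0 := by exact_mod_cast hl.ne'
      push_cast
      field_simp
      ring
    rw [e1, Measure.integral_comp_div (fun y ↦ Φ (v + y)) l, integral_add_left_eq_self Φ v,
      abs_of_pos hl, integral_const_mul, hL _ (by simpa using hσ)]
    simp only [Γ, max_eq_left hσ.le, Complex.real_smul]
    ring
  have hlim : ∀ v : ℝ, ∫ y : ℝ, 𝓕 φ y * h (v + y / l) =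
      ∫ t, φ t * (l * Complex.exp (2 * Real.pi * l * v * t * Complex.I) * Γ 0 t) := by
    intro v
    have hl1 : Tendsto (fun σ : ℝ ↦ ∫ y, 𝓕 φ y * g σ v y) (𝓝[>] 0)
        (𝓝 (∫ y, 𝓕 φ y * h (v + y / l))) := by
      refine tendsto_integral_filter_of_dominated_convergence (fun y ↦ ‖𝓕 φ y‖ * C)
        ?_ ?_ (hF.norm.mul_const C) ?_
      · refine .of_forall fun σ ↦ hF.aestronglyMeasurable.mul ?_
        exact (by fun_prop : Measurable (g σ v)).aestronglyMeasurable
      · filter_upwards [self_mem_nhdsWithin] with σ hσ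
        refine .of_forall fun y ↦ ?_
        rw [norm_mul]
        gcongr
        simp only [g]
        rcases le_or_gt (v + y / l) 0 with hu | hu
        · simpa [h0 _ hu] using hC0
        · rw [norm_mul, Complex.norm_exp]
          refine (mul_le_of_le_one_right (norm_nonneg _) ?_).trans (hC _)
          rw [Real.exp_le_one_iff, ← Complex.ofReal_neg, ← Complex.ofReal_mul, Complex.ofReal_re]
          have : 0 < σ := hσ
          nlinarith
      · refine .of_forall fun y ↦ tendsto_nhdsWithin_of_tendsto_nhds ?_
        have : Continuous fun σ : ℝ ↦ 𝓕 φ y * g σ v y := by simp only [g]; fun_prop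
        simpa [g] using this.tendsto 0
    have hl2 : Tendsto (fun σ : ℝ ↦ ∫ t, φ t *
        (l * Complex.exp (2 * Real.pi * l * v * t * Complex.I) * Γ σ t)) (𝓝[>] 0)
        (𝓝 (∫ t, φ t * (l * Complex.exp (2 * Real.pi * l * v * t * Complex.I) * Γ 0 t))) := by
      have hc := continuous_parametric_integral_of_continuous (μ := (volume : Measure ℝ))
        (f := fun σ t : ℝ ↦ φ t *
        (l * Complex.exp (2 * Real.pi * l * v * t * Complex.I) * Γ σ t))
        (by
          have h2 : Continuous fun p : ℝ × ℝ ↦ Γ p.1 p.2 := hΓ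
          simp only [Function.uncurry_def]
          fun_prop) hsupp
      have hset : ∀ σ, (∫ t in tsupport φ, φ t *
          (l * Complex.exp (2 * Real.pi * l * v * t * Complex.I) * Γ σ t)) =
          ∫ t, φ t * (l * Complex.exp (2 * Real.pi * l * v * t * Complex.I) * Γ σ t) := by
        intro σ
        refine setIntegral_eq_integral_of_forall_compl_eq_zero fun t ht ↦ ?_
        rw [image_eq_zero_of_notMem_tsupport ht, zero_mul]
      simp only [hset] at hc
      exact tendsto_nhdsWithin_of_tendsto_nhds (hc.tendsto 0)
    refine tendsto_nhds_unique (hl1.congr' ?_) hl2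
    filter_upwards [self_mem_nhdsWithin] with σ hσ
    exact hswap σ hσ v
  simp only [hlim]
  have hRL := Real.tendsto_integral_exp_smul_cocompact fun t ↦ φ t * (l * Γ 0 t)
  have hw : Tendsto (fun v : ℝ ↦ -(l * v)) atTop (cocompact ℝ) :=
    (tendsto_neg_atTop_atBot.comp (tendsto_id.const_mul_atTop hl)).mono_right atBot_le_cocompact
  refine (hRL.comp hw).congr fun v ↦ ?_
  simp only [Function.comp]
  congr 1 with t
  rw [Circle.smul_def, Real.fourierChar_apply, smul_eq_mul]
  have : (2 * Real.pi * l * v * t * Complex.I : ℂ) =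
      ↑(2 * Real.pi * -(t * -(l * v))) * Complex.I := by push_cast; ring
  rw [this]
  ring

/-- The Tauberian step: if `e ^ u * B u` is monotone, `B` is bounded, and the averages of `B` against
all dilates of a kernel tend to `1`, then `B` tends to `1`. -/
theorem tendsto_one_of_tendsto_averages {B K : ℝ → ℝ} {C : ℝ} (hm : Measurable B)
    (hB0 : ∀ u, 0 ≤ B u) (hC : ∀ u, B u ≤ C) (hmono : Monotone fun u ↦ Real.exp u * B u)
    (hK : Integrable K) (hK0 : ∀ x, 0 ≤ K x) (hK1 : ∫ x, K x = 1)
    (hA : ∀ l : ℝ, 0 < l → Tendsto (fun v : ℝ ↦ ∫ y : ℝ, K y * B (v + y / l)) atTop (𝓝 1)) :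
    Tendsto B atTop (𝓝 1) := by
  have hC0 : 0 ≤ C := (hB0 0).trans (hC 0)
  have hshift : ∀ u w, u ≤ w → B u ≤ Real.exp (w - u) * B w := by
    intro u w huw
    have h1 : Real.exp u * B u ≤ Real.exp w * B w := hmono huw
    rw [Real.exp_sub, div_mul_eq_mul_div, le_div_iff₀ (Real.exp_pos u)]
    linarith
  have hKBi : ∀ l v : ℝ, Integrable fun y : ℝ ↦ K y * B (v + y / l) := fun l v ↦
    hK.mul_bdd (hm.comp (by fun_prop)).aestronglyMeasurable
      (.of_forall fun y ↦ by rw [Real.norm_of_nonneg (hB0 _)]; exact hC _)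
  have key : ∀ ε : ℝ, 0 < ε → ε < 1 → ∀ᶠ v in atTop,
      (1 - ε - C * ε) * Real.exp (-(2 * ε)) ≤ B v ∧
      B v ≤ (1 + ε) / (1 - ε) * Real.exp (2 * ε) := by
    intro ε hε hε1
    have hlim : Tendsto (fun R : ℝ ↦ ∫ x in (-R)..R, K x) atTop (𝓝 1) := by
      rw [← hK1]
      exact intervalIntegral_tendsto_integral hK tendsto_neg_atTop_atBot tendsto_id
    obtain ⟨R, hR, hR0⟩ := ((hlim.eventually_const_lt (by linarith : 1 - ε < 1)).and
      (eventually_gt_atTop 0)).exists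
    rw [intervalIntegral.integral_of_le (by linarith), ← integral_Icc_eq_integral_Ioc] at hR
    set S := Set.Icc (-R) R with hS
    have hSm : MeasurableSet S := measurableSet_Icc
    set l := R / ε with hl
    have hl0 : 0 < l := by positivity
    have hyl : ∀ y ∈ S, |y / l| ≤ ε := by
      intro y hy
      rw [abs_div, abs_of_pos hl0, div_le_iff₀ hl0, hl, mul_div_cancel₀ _ hε.ne']
      exact abs_le.2 hy
    have hcompl : ∫ x in Sᶜ, K x ≤ ε := by
      have := integral_add_compl hSm hK
      linarith
    have hS1 : ∫ x in S, K x ≤ 1 := by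
      rw [← hK1]
      exact setIntegral_le_integral hK (.of_forall hK0)
    have hA' := hA l hl0
    have hup : ∀ᶠ v in atTop, ∫ y : ℝ, K y * B (v + y / l) < 1 + ε :=
      hA'.eventually_lt_const (by linarith)
    have hlow : ∀ᶠ v in atTop, 1 - ε < ∫ y : ℝ, K y * B (v + y / l) :=
      hA'.eventually_const_lt (by linarith)
    have t1 : Tendsto (fun v : ℝ ↦ v + ε) atTop atTop := tendsto_atTop_add_const_right _ _ tendsto_id
    have t2 : Tendsto (fun v : ℝ ↦ v - ε) atTop atTop := tendsto_atTop_add_const_right _ _ tendsto_id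
    filter_upwards [t1.eventually hup, t2.eventually hlow] with v hv1 hv2
    constructor
    · have h1 : ∫ y in S, K y * B (v - ε + y / l) ≤ Real.exp (2 * ε) * B v := by
        calc ∫ y in S, K y * B (v - ε + y / l)
            ≤ ∫ y in S, K y * (Real.exp (2 * ε) * B v) := by
              refine setIntegral_mono_on (hKBi l _).integrableOn
                (hK.mul_const _).integrableOn hSm fun y hy ↦ ?_
              have h3 := abs_le.1 (hyl y hy)
              refine mul_le_mul_of_nonneg_left ?_ (hK0 y)
              refine (hshift _ v (by linarith)).trans ?_
              have := hB0 v
              gcongr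
              linarith
          _ = (∫ y in S, K y) * (Real.exp (2 * ε) * B v) := integral_mul_const _ _
          _ ≤ 1 * (Real.exp (2 * ε) * B v) := by
              have := hB0 v
              gcongr
          _ = _ := one_mul _
      have h2 : ∫ y in Sᶜ, K y * B (v - ε + y / l) ≤ ε * C := by
        calc ∫ y in Sᶜ, K y * B (v - ε + y / l)
            ≤ ∫ y in Sᶜ, K y * C :=
              setIntegral_mono_on (hKBi l _).integrableOn (hK.mul_const _).integrableOn
                hSm.compl fun y _ ↦ mul_le_mul_of_nonneg_left (hC _) (hK0 y)
          _ = (∫ y in Sᶜ, K y) * C := integral_mul_const _ _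
          _ ≤ ε * C := by gcongr
      have h3 := integral_add_compl hSm (hKBi l (v - ε))
      rw [Real.exp_neg, ← div_eq_mul_inv, div_le_iff₀ (Real.exp_pos _)]
      linarith
    · have h1 : (1 - ε) * (B v * Real.exp (-(2 * ε))) ≤ 1 + ε := by
        calc (1 - ε) * (B v * Real.exp (-(2 * ε)))
            ≤ (∫ y in S, K y) * (B v * Real.exp (-(2 * ε))) := by
              have := hB0 v
              gcongr
          _ = ∫ y in S, K y * (B v * Real.exp (-(2 * ε))) := (integral_mul_const _ _).symm
          _ ≤ ∫ y in S, K y * B (v + ε + y / l) := by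
              refine setIntegral_mono_on (hK.mul_const _).integrableOn
                (hKBi l _).integrableOn hSm fun y hy ↦ ?_
              have h3 := abs_le.1 (hyl y hy)
              refine mul_le_mul_of_nonneg_left ?_ (hK0 y)
              rw [Real.exp_neg, ← div_eq_mul_inv, div_le_iff₀ (Real.exp_pos _), mul_comm]
              refine (hshift v (v + ε + y / l) (by linarith)).trans ?_
              have := hB0 (v + ε + y / l)
              gcongr
              linarith
          _ ≤ ∫ y, K y * B (v + ε + y / l) :=
              setIntegral_le_integral (hKBi l _)
                (.of_forall fun y ↦ mul_nonneg (hK0 y) (hB0 _))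
          _ ≤ 1 + ε := hv1.le
      rw [Real.exp_neg, ← div_eq_mul_inv, ← mul_div_assoc, div_le_iff₀ (Real.exp_pos _)] at h1
      rw [div_mul_eq_mul_div, le_div_iff₀ (by linarith)]
      linarith
  have hmem : Set.Ioo (0 : ℝ) 1 ∈ 𝓝[>] (0 : ℝ) := Ioo_mem_nhdsGT one_pos
  refine tendsto_order.2 ⟨fun a ha ↦ ?_, fun a ha ↦ ?_⟩
  · have hc : Tendsto (fun ε : ℝ ↦ (1 - ε - C * ε) * Real.exp (-(2 * ε))) (𝓝[>] 0) (𝓝 1) := by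
      refine tendsto_nhdsWithin_of_tendsto_nhds ?_
      have : Continuous (fun ε : ℝ ↦ (1 - ε - C * ε) * Real.exp (-(2 * ε))) := by fun_prop
      simpa using this.tendsto 0
    obtain ⟨ε, h1, h2⟩ := ((hc.eventually_const_lt ha).and hmem).exists
    filter_upwards [key ε h2.1 h2.2] with v hv using h1.trans_le hv.1
  · have hc : Tendsto (fun ε : ℝ ↦ (1 + ε) / (1 - ε) * Real.exp (2 * ε)) (𝓝[>] 0) (𝓝 1) := by
      refine tendsto_nhdsWithin_of_tendsto_nhds ?_
      have : ContinuousAt (fun ε : ℝ ↦ (1 + ε) / (1 - ε) * Real.exp (2 * ε)) 0 := by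
        fun_prop (disch := norm_num)
      simpa using this.tendsto
    obtain ⟨ε, h1, h2⟩ := ((hc.eventually_lt_const ha).and hmem).exists
    filter_upwards [key ε h2.1 h2.2] with v hv using hv.2.trans_lt h1

/-- A **Wiener–Ikehara theorem** for bounded functions, in Laplace transform form. -/
theorem tendsto_one_of_laplace_transform {B : ℝ → ℝ} {C : ℝ} (hm : Measurable B)
    (hB0 : ∀ u, 0 ≤ B u) (hC : ∀ u, B u ≤ C) (hneg : ∀ u ≤ 0, B u = 0)
    (hmono : Monotone fun u ↦ Real.exp u * B u) {G : ℂ → ℂ}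
    (hG : ContinuousOn G {s | 0 ≤ s.re})
    (hL : ∀ s : ℂ, 0 < s.re →
      ∫ u in Set.Ioi (0 : ℝ), ((B u : ℂ) - 1) * Complex.exp (-s * u) = G s) :
    Tendsto B atTop (𝓝 1) := by
  obtain ⟨φ, K, hφ, hsupp, hK, hK0, hK1, hFK⟩ := exists_fejer_kernel
  have hC0 : 0 ≤ C := (hB0 0).trans (hC 0)
  refine tendsto_one_of_tendsto_averages hm hB0 hC hmono hK hK0 hK1 fun l hl ↦ ?_
  let H : ℝ → ℝ := (Set.Ioi 0).indicator 1
  have hHm : Measurable H := measurable_one.indicator measurableSet_Ioi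
  have hH : ∀ u, ‖H u‖ ≤ 1 := fun u ↦
    (norm_indicator_le_norm_self _ _).trans (by simp)
  have hz := tendsto_integral_fourier_mul_comp_zero (h := fun u ↦ ((B u - H u : ℝ) : ℂ))
    (C := C + 1) (by fun_prop)
    (fun u ↦ by
      rw [Complex.norm_real]
      refine (norm_sub_le _ _).trans (add_le_add ?_ (hH u))
      rw [Real.norm_of_nonneg (hB0 u)]
      exact hC u)
    (fun u hu ↦ by simp [H, hneg u hu, hu]) hG
    (fun s hs ↦ by
      rw [← hL s hs, ← integral_indicator measurableSet_Ioi]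
      congr 1 with u
      rcases le_or_gt u 0 with hu | hu
      · simp [H, hneg u hu, hu]
      · simp [H, hu]) hφ hsupp (hK.ofReal.congr hFK.symm) hl
  have hBi : ∀ v : ℝ, Integrable fun y : ℝ ↦ K y * B (v + y / l) := fun v ↦
    hK.mul_bdd (hm.comp (by fun_prop)).aestronglyMeasurable
      (.of_forall fun y ↦ by rw [Real.norm_of_nonneg (hB0 _)]; exact hC _)
  have hHi : ∀ v : ℝ, Integrable fun y : ℝ ↦ K y * H (v + y / l) := fun v ↦
    hK.mul_bdd (hHm.comp (by fun_prop)).aestronglyMeasurable (.of_forall fun y ↦ hH _)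
  have hz' : Tendsto (fun v : ℝ ↦ ∫ y : ℝ, K y * (B (v + y / l) - H (v + y / l))) atTop (𝓝 0) := by
    rw [← Complex.ofReal_zero] at hz
    refine (Complex.continuous_re.tendsto _).comp hz |>.congr fun v ↦ ?_
    simp only [Function.comp]
    rw [integral_congr_ae (g := fun y : ℝ ↦ ((K y * (B (v + y / l) - H (v + y / l)) : ℝ) : ℂ)),
      integral_complex_ofReal, Complex.ofReal_re]
    filter_upwards [hFK] with y hy
    rw [hy]
    push_cast
    ring
  have hone : Tendsto (fun v : ℝ ↦ ∫ y : ℝ, K y * H (v + y / l)) atTop (𝓝 1) := by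
    rw [← hK1]
    refine tendsto_integral_filter_of_dominated_convergence K
      (.of_forall fun v ↦ (hHi v).aestronglyMeasurable) (.of_forall fun v ↦ .of_forall fun y ↦ ?_)
      hK (.of_forall fun y ↦ ?_)
    · rw [norm_mul, Real.norm_of_nonneg (hK0 y)]
      exact mul_le_of_le_one_right (hK0 y) (hH _)
    · refine tendsto_const_nhds.congr' ?_
      filter_upwards [eventually_gt_atTop (-(y / l))] with v hv
      have : 0 < v + y / l := by linarith
      simp [H, this]
  have := hz'.add hone
  rw [zero_add] at this
  refine this.congr fun v ↦ ?_
  simp only [mul_sub]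
  rw [integral_sub (hBi v) (hHi v), sub_add_cancel]

open ArithmeticFunction in
/-- The Dirichlet series of `Λ` as a Laplace transform of `u ↦ ψ (e ^ u) / e ^ u`. -/
theorem LSeries_vonMangoldt_eq_mul_integral_psi {s : ℂ} (hs : 1 < s.re) :
    LSeries (fun n ↦ (vonMangoldt n : ℂ)) s =
      s * ∫ t in Set.Ioi (1 : ℝ), (Chebyshev.psi t : ℂ) * (t : ℂ) ^ (-(s + 1)) := by
  rw [LSeries_eq_mul_integral_of_nonneg (fun n ↦ vonMangoldt n) zero_le_one hs ?_
    fun n ↦ vonMangoldt_nonneg]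
  · congr 2 with t
    rw [Chebyshev.psi, ← Finset.Icc_add_one_left_eq_Ioc, zero_add]
    push_cast
    rfl
  · refine Asymptotics.IsBigO.of_bound (Real.log 4 + 4) (.of_forall fun n ↦ ?_)
    have h1 := Chebyshev.psi_le_const_mul_self (x := n) (Nat.cast_nonneg n)
    have h2 := Chebyshev.psi_nonneg (n : ℝ)
    have h3 : (∑ k ∈ Finset.Icc 1 n, vonMangoldt k) = Chebyshev.psi n := by
      rw [Chebyshev.psi, Nat.floor_natCast, ← Finset.Icc_add_one_left_eq_Ioc, zero_add]
    rw [h3, Real.norm_of_nonneg h2, Real.rpow_one, Real.norm_of_nonneg (Nat.cast_nonneg n)]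
    exact h1

open ArithmeticFunction in
/-- The **Prime Number Theorem** for the Chebyshev function `ψ`. -/
theorem tendsto_psi_div_self : Tendsto (fun x : ℝ ↦ Chebyshev.psi x / x) atTop (𝓝 1) := by
  let B : ℝ → ℝ := fun u ↦ Chebyshev.psi (Real.exp u) / Real.exp u
  let G : ℂ → ℂ := fun s ↦
    (vonMangoldt.LFunctionResidueClassAux (1 : ZMod 1) (1 + s) - 1) / (1 + s)
  have hm : Measurable B :=
    (Chebyshev.psi_mono.measurable.comp Real.measurable_exp).div Real.measurable_exp
  have hB0 : ∀ u, 0 ≤ B u := fun u ↦ div_nonneg (Chebyshev.psi_nonneg _) (Real.exp_pos u).le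
  have hC : ∀ u, B u ≤ Real.log 4 + 4 := fun u ↦
    (div_le_iff₀ (Real.exp_pos u)).2 (Chebyshev.psi_le_const_mul_self (Real.exp_pos u).le)
  have hneg : ∀ u ≤ 0, B u = 0 := fun u hu ↦ by
    simp [B, Chebyshev.psi_eq_zero_of_le_one (Real.exp_le_one_iff.2 hu)]
  have hexpB : ∀ u, Real.exp u * B u = Chebyshev.psi (Real.exp u) := fun u ↦
    mul_div_cancel₀ _ (Real.exp_pos u).ne'
  have hmono : Monotone fun u ↦ Real.exp u * B u := by
    simp only [hexpB]
    exact Chebyshev.psi_mono.comp Real.exp_monotone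
  have hne : ∀ s : ℂ, 0 ≤ s.re → 1 + s ≠ 0 := by
    intro s hs h
    have := congrArg Complex.re h
    simp at this
    linarith
  have hG : ContinuousOn G {s | 0 ≤ s.re} := by
    refine ContinuousOn.div (ContinuousOn.sub ?_ continuousOn_const) (by fun_prop)
      fun s hs ↦ hne s hs
    refine (vonMangoldt.continuousOn_LFunctionResidueClassAux (1 : ZMod 1)).comp
      (by fun_prop) fun s hs ↦ ?_
    have : 0 ≤ s.re := hs
    simpa using this
  have hint : ∀ s : ℂ, 0 < s.re →
      IntegrableOn (fun u : ℝ ↦ Complex.exp (-s * u)) (Set.Ioi 0) := fun s hs ↦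
    integrableOn_exp_mul_complex_Ioi (by simpa using hs) 0
  have hL : ∀ s : ℂ, 0 < s.re →
      ∫ u in Set.Ioi (0 : ℝ), ((B u : ℂ) - 1) * Complex.exp (-s * u) = G s := by
    intro s hs
    have h1 : 1 < (1 + s).re := by simpa using hs
    have hs0 : s ≠ 0 := by rintro rfl; simp at hs
    have hAux := vonMangoldt.eqOn_LFunctionResidueClassAux (isUnit_one : IsUnit (1 : ZMod 1)) h1
    have hres : (fun n ↦ (vonMangoldt.residueClass (1 : ZMod 1) n : ℂ)) =
        fun n ↦ (vonMangoldt n : ℂ) := by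
      ext n
      simp [vonMangoldt.residueClass, Subsingleton.elim _ (1 : ZMod 1)]
    simp only [hres] at hAux
    have hB : ∫ u in Set.Ioi (0 : ℝ), (B u : ℂ) * Complex.exp (-s * u) =
        ∫ t in Set.Ioi (1 : ℝ), (Chebyshev.psi t : ℂ) * (t : ℂ) ^ (-((1 + s) + 1)) := by
      rw [← Real.exp_zero, ← integral_comp_exp_Ioi]
      refine setIntegral_congr_fun measurableSet_Ioi fun u _ ↦ ?_
      simp only [B]
      rw [Complex.cpow_def_of_ne_zero (by exact_mod_cast (Real.exp_pos u).ne'),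
        ← Complex.ofReal_log (Real.exp_pos u).le, Real.log_exp, Complex.real_smul]
      have : Complex.exp (u * (-((1 + s) + 1))) =
          Complex.exp (-s * u) / (Complex.exp u * Complex.exp u) := by
        rw [← Complex.exp_add, ← Complex.exp_sub]
        congr 1
        ring
      rw [this]
      push_cast
      have := Complex.exp_ne_zero u
      field_simp
    have hBint : IntegrableOn (fun u : ℝ ↦ (B u : ℂ) * Complex.exp (-s * u)) (Set.Ioi 0) := by
      refine (hint s hs).bdd_mul (c := Real.log 4 + 4) (by fun_prop) (.of_forall fun u ↦ ?_)
      rw [Complex.norm_real, Real.norm_of_nonneg (hB0 u)]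
      exact hC u
    simp only [sub_mul, one_mul]
    rw [integral_sub hBint (hint s hs), hB, integral_exp_mul_complex_Ioi (by simpa using hs)]
    have hLS := LSeries_vonMangoldt_eq_mul_integral_psi h1
    simp only [G]
    rw [hAux, hLS]
    have := hne s hs.le
    simp
    field_simp
    ring
  have := (tendsto_one_of_laplace_transform hm hB0 hC hneg hmono hG hL).comp Real.tendsto_log_atTop
  refine this.congr' ?_
  filter_upwards [eventually_gt_atTop 0] with x hx
  simp [B, Real.exp_log hx]

/-- The **Prime Number Theorem** for the Chebyshev function `θ`. -/
theorem tendsto_theta_div_self : Tendsto (fun x : ℝ ↦ Chebyshev.theta x / x) atTop (𝓝 1) := by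
  have h : Tendsto (fun x : ℝ ↦ (Chebyshev.psi - Chebyshev.theta) x / x) atTop (𝓝 0) := by
    refine (Chebyshev.isBigO_psi_sub_theta_sqrt.trans_isLittleO ?_).tendsto_div_nhds_zero
    refine (Asymptotics.isLittleO_iff_tendsto' ?_).2 ?_
    · filter_upwards [eventually_ne_atTop 0] with x hx h using absurd h hx
    · simp only [Real.sqrt_div_self]
      simpa only [one_div] using! Real.tendsto_sqrt_atTop.inv_tendsto_atTop
  have := tendsto_psi_div_self.sub h
  rw [sub_zero] at this
  refine this.congr fun x ↦ ?_
  simp only [Pi.sub_apply]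
  ring

/-- The **Prime Number Theorem**. -/
theorem tendsto_primeCounting_mul_log_div :
    Tendsto (fun x : ℝ ↦ (Nat.primeCounting ⌊x⌋₊ : ℝ) * Real.log x / x) atTop (𝓝 1) := by
  have h := Chebyshev.integral_theta_div_log_sq_isLittleO.tendsto_div_nhds_zero
  have := tendsto_theta_div_self.add h
  rw [add_zero] at this
  refine this.congr' ?_
  filter_upwards [eventually_ge_atTop 2] with x hx
  have : 0 < Real.log x := Real.log_pos (by linarith)
  rw [Chebyshev.primeCounting_eq_theta_div_log_add_integral hx]
  field_simp

/-- `π(x) - π(x / 2)` is asymptotic to `x / (2 log x)`. -/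
theorem tendsto_primeCounting_sub_half_mul_log_div :
    Tendsto (fun x : ℕ ↦ ((Nat.primeCounting x - Nat.primeCounting (x / 2) : ℕ) : ℝ) *
      (2 * Real.log x) / x) atTop (𝓝 1) := by
  have h1 := tendsto_primeCounting_mul_log_div.comp (tendsto_natCast_atTop_atTop (R := ℝ))
  have hhalf : Tendsto (fun x : ℕ ↦ (x : ℝ) / 2) atTop atTop :=
    tendsto_natCast_atTop_atTop.atTop_div_const two_pos
  have h2 := tendsto_primeCounting_mul_log_div.comp hhalf
  have hlog : Tendsto (fun x : ℕ ↦ Real.log 2 / Real.log ((x : ℝ) / 2)) atTop (𝓝 0) :=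
    tendsto_const_nhds.div_atTop (Real.tendsto_log_atTop.comp hhalf)
  have h3 := (h1.const_mul 2).sub (h2.mul (hlog.add_const 1))
  have : (2 * 1 - 1 * (0 + 1) : ℝ) = 1 := by norm_num
  rw [this] at h3
  refine h3.congr' ?_
  filter_upwards [eventually_gt_atTop 2] with x hx
  have hx' : (2 : ℝ) < x := by exact_mod_cast hx
  have hl : 0 < Real.log ((x : ℝ) / 2) := Real.log_pos (by linarith)
  have hfl : ⌊(x : ℝ) / 2⌋₊ = x / 2 := by
    simpa using Nat.floor_div_natCast (x : ℝ) 2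
  have hxl : Real.log x = Real.log 2 + Real.log ((x : ℝ) / 2) := by
    rw [Real.log_div (by linarith) (by norm_num)]
    ring
  simp only [Function.comp, Nat.floor_natCast, hfl]
  rw [Nat.cast_sub (Nat.monotone_primeCounting (Nat.div_le_self x 2)), hxl]
  field_simp

theorem exists_forall_le_primeCounting_sub_half (n : ℕ) :
    ∃ R : ℕ, 0 < R ∧ ∀ x : ℕ, R ≤ x →
      n ≤ Nat.primeCounting x - Nat.primeCounting (x / 2) := by
  have hlog : Tendsto (fun x : ℕ ↦ Real.log x / x) atTop (𝓝 0) :=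
    Real.isLittleO_log_id_atTop.tendsto_div_nhds_zero.comp tendsto_natCast_atTop_atTop
  have h0 : Tendsto (fun x : ℕ ↦ n * 2 * (Real.log x / x)) atTop (𝓝 0) := by
    simpa using hlog.const_mul (n * 2 : ℝ)
  obtain ⟨N, hN⟩ := eventually_atTop.1
    ((h0.eventually_lt tendsto_primeCounting_sub_half_mul_log_div one_pos).and
      (eventually_gt_atTop 1))
  refine ⟨N + 1, N.succ_pos, fun x hx ↦ ?_⟩
  obtain ⟨h1, h2⟩ := hN x (by omega)
  have hx1 : (1 : ℝ) < x := by exact_mod_cast h2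
  have hl : 0 < Real.log x / x := div_pos (Real.log_pos hx1) (by linarith)
  have h3 : (n : ℝ) * (2 * (Real.log x / x)) <
      ((Nat.primeCounting x - Nat.primeCounting (x / 2) : ℕ) : ℝ) * (2 * (Real.log x / x)) := by
    exact lt_of_eq_of_lt (by ring) (h1.trans_eq (by ring))
  have h4 := lt_of_mul_lt_mul_right h3 (by positivity)
  exact_mod_cast h4.le

theorem le_primeCounting_sub_half_of_ramanujan_le {n x : ℕ} (h : ramanujan n ≤ x) :
    n ≤ Nat.primeCounting x - Nat.primeCounting (x / 2) :=
  (Nat.sInf_mem (exists_forall_le_primeCounting_sub_half n)).2 x h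

theorem ramanujan_pos (n : ℕ) : 0 < ramanujan n :=
  (Nat.sInf_mem (exists_forall_le_primeCounting_sub_half n)).1

theorem ramanujan_le {n R : ℕ} (hR : 0 < R)
    (h : ∀ x, R ≤ x → n ≤ Nat.primeCounting x - Nat.primeCounting (x / 2)) : ramanujan n ≤ R :=
  Nat.sInf_le ⟨hR, h⟩

theorem ramanujan_mono : Monotone ramanujan := fun _ _ hmn ↦
  ramanujan_le (ramanujan_pos _) fun _ hx ↦
    hmn.trans (le_primeCounting_sub_half_of_ramanujan_le hx)

theorem primeCounting_sub_half_succ_le (x : ℕ) :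
    Nat.primeCounting (x + 1) - Nat.primeCounting ((x + 1) / 2) ≤
      Nat.primeCounting x - Nat.primeCounting (x / 2) + 1 := by
  have h1 : Nat.primeCounting (x + 1) ≤ Nat.primeCounting x + 1 := by
    simp only [Nat.primeCounting, Nat.primeCounting', Nat.count_succ _ (x + 1)]
    split_ifs <;> omega
  have h2 : Nat.primeCounting (x / 2) ≤ Nat.primeCounting ((x + 1) / 2) :=
    Nat.monotone_primeCounting (by omega)
  omega

/-- The defining inequality of the `n`-th Ramanujan prime is an equality at that prime. -/
theorem primeCounting_sub_half_ramanujan (n : ℕ) :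
    Nat.primeCounting (ramanujan n) - Nat.primeCounting (ramanujan n / 2) = n := by
  refine le_antisymm ?_ (le_primeCounting_sub_half_of_ramanujan_le le_rfl)
  by_contra! hlt
  obtain ⟨r, hr⟩ := Nat.exists_eq_add_one_of_ne_zero (ramanujan_pos n).ne'
  have hstep := primeCounting_sub_half_succ_le r
  rw [hr] at hlt
  have hr0 : 0 < r := by
    rcases Nat.eq_zero_or_pos r with rfl | h
    · simp [Nat.primeCounting_one] at hlt
    · exact h
  have : ramanujan n ≤ r := ramanujan_le hr0 fun x hx ↦ by
    rcases hx.eq_or_lt with rfl | hx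
    · omega
    · exact le_primeCounting_sub_half_of_ramanujan_le (by omega)
  omega

theorem ramanujan_injective : Function.Injective ramanujan := fun m n h ↦ by
  rw [← primeCounting_sub_half_ramanujan m, h, primeCounting_sub_half_ramanujan n]

theorem countRam_le (x : ℕ) :
    countRam x ≤ Nat.primeCounting x - Nat.primeCounting (x / 2) := by
  classical
  have hsub : (Finset.range (x + 1)).filter IsRamanujanPrime ⊆
      (Finset.Icc 1 (Nat.primeCounting x - Nat.primeCounting (x / 2))).image ramanujan := by
    intro p hp
    obtain ⟨hpx, n, hn, rfl⟩ := Finset.mem_filter.1 hp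
    refine Finset.mem_image_of_mem _ (Finset.mem_Icc.2 ⟨hn, ?_⟩)
    exact le_primeCounting_sub_half_of_ramanujan_le (Finset.mem_range_succ_iff.1 hpx)
  have := (Finset.card_le_card hsub).trans Finset.card_image_le
  rw [Nat.card_Icc, Nat.add_sub_cancel] at this
  unfold countRam
  convert this

theorem le_countRam {m x : ℕ} (h : ramanujan m ≤ x) : m ≤ countRam x := by
  classical
  have hsub : (Finset.Icc 1 m).image ramanujan ⊆
      (Finset.range (x + 1)).filter IsRamanujanPrime := by
    intro p hp
    obtain ⟨n, hn, rfl⟩ := Finset.mem_image.1 hp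
    obtain ⟨hn1, hnm⟩ := Finset.mem_Icc.1 hn
    exact Finset.mem_filter.2
      ⟨Finset.mem_range_succ_iff.2 ((ramanujan_mono hnm).trans h), n, hn1, rfl⟩
  have := Finset.card_le_card hsub
  rw [Finset.card_image_of_injective _ ramanujan_injective, Nat.card_Icc, Nat.add_sub_cancel] at this
  unfold countRam
  convert this

theorem div_log_le_div_log {x y : ℝ} (hx : 3 ≤ x) (hxy : x ≤ y) :
    x / Real.log x ≤ y / Real.log y := by
  have he : Real.exp 1 ≤ x := Real.exp_one_lt_d9.le.trans (by linarith)
  have h := Real.log_div_self_antitoneOn he (he.trans hxy) hxy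
  have hy : 0 < Real.log y / y := div_pos (Real.log_pos (by linarith)) (by linarith)
  simpa only [inv_div] using inv_anti₀ hy h

/-- Assuming Sondow's asymptotic R_n ~ p_{2n}, one has π_R(x) ~ x/(2 ln x),
i.e. π_R(x)·(2 ln x)/x → 1 as x → ∞. -/
theorem countRam_asymptotic
    (hR : Filter.Tendsto (fun n : ℕ => (ramanujan n : ℝ) / (nthPrime (2 * n) : ℝ))
      Filter.atTop (nhds 1)) :
    Filter.Tendsto (fun x : ℕ => (countRam x : ℝ) * (2 * Real.log x) / (x : ℝ))
      Filter.atTop (nhds 1) := by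
  have hD := tendsto_primeCounting_sub_half_mul_log_div
  refine tendsto_order.2 ⟨fun a ha ↦ ?_, fun a ha ↦ ?_⟩
  · obtain ⟨b, hab, hb⟩ := exists_between (max_lt ha one_pos)
    have hb0 : 0 < b := (le_max_right _ _).trans_lt hab
    have hlog : Tendsto (fun x : ℕ ↦ 2 * (Real.log x / x)) atTop (𝓝 0) := by
      simpa using (Real.isLittleO_log_id_atTop.tendsto_div_nhds_zero.comp
        tendsto_natCast_atTop_atTop).const_mul (2 : ℝ)
    obtain ⟨N, hN⟩ := eventually_atTop.1 (hD.eventually_const_lt hb)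
    filter_upwards [eventually_ge_atTop N, eventually_ge_atTop 3,
      hlog.eventually_lt_const (sub_pos.2 ((le_max_left _ _).trans_lt hab))] with x hxN hx3 hxl
    have hx3' : (3 : ℝ) ≤ x := by exact_mod_cast hx3
    have hlx : 0 < Real.log x := Real.log_pos (by linarith)
    have hx0 : (0 : ℝ) < x := by linarith
    have hm : ramanujan ⌊b / 2 * (x / Real.log x)⌋₊ ≤ x := by
      refine ramanujan_le (by omega) fun y hxy ↦ Nat.floor_le_of_le ?_
      have hxy' : (x : ℝ) ≤ y := by exact_mod_cast hxy
      have hly : 0 < Real.log y := Real.log_pos (by linarith)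
      have h1 := hN y (hxN.trans hxy)
      rw [lt_div_iff₀ (by linarith)] at h1
      calc b / 2 * (x / Real.log x) ≤ b / 2 * (y / Real.log y) := by
            exact mul_le_mul_of_nonneg_left (div_log_le_div_log hx3' hxy') (by positivity)
        _ = b * y / (2 * Real.log y) := by field_simp
        _ ≤ _ := by
            rw [div_le_iff₀ (by positivity)]
            exact h1.le
    have h2 : b / 2 * (x / Real.log x) < countRam x + 1 :=
      (Nat.lt_floor_add_one _).trans_le (by exact_mod_cast Nat.succ_le_succ (le_countRam hm))
    have h3 : b < (countRam x + 1) * (2 * (Real.log x / x)) := by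
      calc b = b / 2 * (x / Real.log x) * (2 * (Real.log x / x)) := by field_simp
        _ < _ := by gcongr
    have h4 : (countRam x : ℝ) * (2 * Real.log x) / x =
        countRam x * (2 * (Real.log x / x)) := by ring
    rw [h4]
    linarith
  · filter_upwards [hD.eventually_lt_const ha, eventually_ge_atTop 1] with x hx hx1
    have : 0 ≤ Real.log x := Real.log_natCast_nonneg x
    refine lt_of_le_of_lt ?_ hx
    gcongr
    exact countRam_le x
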